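/- Let s ≥ 1, let Ω ⊂ ℂ^s be a finite set, let f_ω ∈ ℂ∖{0} for ω ∈ Ω, and define f: ℤ^s → ℂ by f(x) = ∑_{ω∈Ω} f_ω e^{ωᵀx}. Let A, B ⊂ ℕ₀^s be finite sets, let F_{A,B} = [f(α−β)]_{α∈A, β∈B}, and assume that the vectors ((e^{ω})^α)_{α∈A} ∈ ℂ^A, for ω ∈ Ω, are linearly independent. If a vector (p_β)_{β∈B} lies in the kernel of F_{A,B}, then the polynomial p(z) = ∑_{β∈B} p_β z^β vanishes at every point e^{−ω} = (e^{−ω₁},…,e^{−ω_s}), ω ∈ Ω. Combined with the converse direction, under these hypotheses the kernel of F_{A,B} consists exactly of the coefficient vectors, supported on B, of polynomials vanishing at all points e^{−ω}, ω ∈ Ω. -/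

import Mathlib

open Matrix

/-- The exponential `e^{ωᵀ(α−β)}` splits into the monomials `(e^ω)^α` and `(e^{−ω})^β`. -/
theorem exp_sum_mul_sub {ι : Type*} [Fintype ι] (ω : ι → ℂ) (a b : ι → ℕ) :
    Complex.exp (∑ i, ω i * (((a i : ℤ) - (b i : ℤ) : ℤ) : ℂ)) =
      (∏ i, Complex.exp (ω i) ^ a i) * ∏ i, Complex.exp (-ω i) ^ b i := by
  rw [Complex.exp_sum, ← Finset.prod_mul_distrib]
  refine Finset.prod_congr rfl fun i _ => ?_
  rw [← Complex.exp_nat_mul, ← Complex.exp_nat_mul, ← Complex.exp_add]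
  push_cast
  ring_nf

/-- structure theorem for the kernel of the multivariate Prony–Hankel matrix.
If `f(x) = ∑_{ω∈Ω} f_ω e^{ωᵀx}` with all `f_ω ≠ 0` and the vectors `((e^ω)^α)_{α∈A}`,
`ω ∈ Ω`, are linearly independent, then a coefficient vector `(p_β)_{β∈B}` lies in the
kernel of `F_{A,B} = [f(α−β)]` if and only if the polynomial `p(z) = ∑_{β∈B} p_β z^β`
vanishes at all points `e^{−ω}`, `ω ∈ Ω`. -/
theorem prony_kernel_iff_vanishing
    (s : ℕ) (hs : 1 ≤ s)
    (Ω : Finset (Fin s → ℂ)) (c : (Fin s → ℂ) → ℂ)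
    (hc : ∀ ω ∈ Ω, c ω ≠ 0)
    (f : (Fin s → ℤ) → ℂ)
    (hf : f = fun x => ∑ ω ∈ Ω, c ω * Complex.exp (∑ i, ω i * (x i : ℂ)))
    (A B : Finset (Fin s → ℕ))
    (F : Matrix A B ℂ)
    (hF : ∀ (α : A) (β : B), F α β = f (fun i => (α.1 i : ℤ) - (β.1 i : ℤ)))
    (hind : LinearIndependent ℂ
      (fun ω : Ω => fun α : A => ∏ i, Complex.exp (ω.1 i) ^ (α.1 i)))
    (p : B → ℂ) :
    F.mulVec p = 0 ↔
      ∀ ω ∈ Ω, ∑ β : B, p β * ∏ i, Complex.exp (-ω i) ^ (β.1 i) = 0 := by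
  have hmul : F.mulVec p = ∑ ω : Ω,
      (c ω.1 * ∑ β : B, p β * ∏ i, Complex.exp (-ω.1 i) ^ (β.1 i)) •
        fun α : A => ∏ i, Complex.exp (ω.1 i) ^ (α.1 i) := by
    ext α
    simp only [Matrix.mulVec, dotProduct, hF, hf, exp_sum_mul_sub, Finset.sum_apply,
      Pi.smul_apply, smul_eq_mul, Finset.mul_sum, Finset.sum_mul]
    rw [Finset.sum_comm, ← Finset.sum_coe_sort Ω]
    refine Finset.sum_congr rfl fun ω _ => Finset.sum_congr rfl fun β _ => ?_
    ring
  rw [hmul]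
  constructor
  · intro h ω hω
    exact (mul_eq_zero.mp (Fintype.linearIndependent_iff.mp hind _ h ⟨ω, hω⟩)).resolve_left
      (hc ω hω)
  · intro h
    refine Finset.sum_eq_zero fun ω _ => ?_
    rw [h ω.1 ω.2, mul_zero, zero_smul]
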